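/- arXiv:2505.04296 — 3 statements merged into one kernel-verified Lean document; each statement's English description precedes it below -/
import Mathlib

section
/- For every prime n ≥ 5, every coefficient of the polynomial p_n(z; x, y) − (x + y + z)ⁿ ∈ ℤ[x, y, z] is divisible by n⁴, and the polynomial is divisible by the monomial xyz. -/
noncomputable def pn (n : ℕ) (z x y : ℂ) : ℂ :=
  ∏ r : Fin n, ∏ s : Fin n,
    (z ^ (n : ℂ)⁻¹
      + Complex.exp (2 * Real.pi * Complex.I * ((r : ℕ) + 1) / n) * x ^ (n : ℂ)⁻¹
      + Complex.exp (2 * Real.pi * Complex.I * ((s : ℕ) + 1) / n) * y ^ (n : ℂ)⁻¹)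

section Aux
open Finset

theorem newton_dvd {R : Type*} [CommRing R] (N m : ℕ) (h2 : Nat.Coprime m 2) (h3 : Nat.Coprime m 3)
    (S : R) (g : Fin N → R) (p1 : ∑ i, g i = 0) (p2 : (m : R) ^ 2 ∣ ∑ i, g i ^ 2)
    (p3 : (m : R) ∣ ∑ i, g i ^ 3) :
    (m : R) ^ 4 ∣ ∏ i, (S + m * g i) - S ^ N := by
  classical
  set a : Fin N → R := fun i => m * g i with ha
  have hprod : ∏ i, (S + m * g i) =
      ∑ j ∈ range (N + 1), MvPolynomial.aeval a (MvPolynomial.esymm (Fin N) R j) * S ^ (N - j) := by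
    have := congrArg (Polynomial.eval S)
      (Multiset.prod_X_add_C_eq_sum_esymm ((univ : Finset (Fin N)).val.map a))
    simp only [Multiset.map_map, Multiset.card_map, Finset.card_val, Finset.card_univ,
      Fintype.card_fin, Polynomial.eval_finsetSum, Polynomial.eval_mul, Polynomial.eval_pow,
      Polynomial.eval_X, Polynomial.eval_C] at this
    simp only [MvPolynomial.aeval_esymm_eq_multiset_esymm]
    rw [← this]
    rw [Polynomial.eval_multiset_prod, Multiset.map_map]
    change (Multiset.map _ _).prod = _
    congr 1
    refine Multiset.map_congr rfl fun i _ => ?_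
    simp [ha]
  have hN (k : ℕ) := congrArg (MvPolynomial.aeval a) (MvPolynomial.mul_esymm_eq_sum (Fin N) R k)
  set e : ℕ → R := fun j => MvPolynomial.aeval a (MvPolynomial.esymm (Fin N) R j) with he
  have e0 : e 0 = 1 := by simp [he, MvPolynomial.esymm_zero]
  have e1 : e 1 = 0 := by
    simp [he, MvPolynomial.esymm_one, ha, ← mul_sum, p1]
  have P1 : ∑ i, a i = 0 := by simp [ha, ← mul_sum, p1]
  have e2 : 2 * e 2 = - ((m : R) ^ 2 * ∑ i, g i ^ 2) := by
    have := hN 2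
    simp only [map_mul, map_sum, sum_filter, Nat.sum_antidiagonal_eq_sum_range_succ_mk,
      sum_range_succ, map_pow, map_neg, map_one, MvPolynomial.psum, MvPolynomial.aeval_X,
      apply_ite, map_natCast] at this
    simp [-MvPolynomial.aeval_eq_eval, -MvPolynomial.coe_aeval_eq_eval, P1, MvPolynomial.esymm_zero] at this
    rw [he]; simp only; rw [this, ha]; simp [mul_pow, ← mul_sum]; ring
  have e3 : 3 * e 3 = (m : R) ^ 3 * ∑ i, g i ^ 3 := by
    have := hN 3
    simp only [map_mul, map_sum, sum_filter, Nat.sum_antidiagonal_eq_sum_range_succ_mk,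
      sum_range_succ, map_pow, map_neg, map_one, MvPolynomial.psum, MvPolynomial.aeval_X,
      apply_ite, map_natCast] at this
    have e1' := e1
    rw [he] at e1'
    simp only at e1'
    simp [-MvPolynomial.aeval_eq_eval, -MvPolynomial.coe_aeval_eq_eval, P1, MvPolynomial.esymm_zero, e1'] at this
    rw [he]; simp only; rw [this, ha]; simp [mul_pow, ← mul_sum]; ring
  have canc (q : ℕ) (hq : Nat.Coprime m q) (x : R) (h : (m : R) ^ 4 ∣ q * x) : (m : R) ^ 4 ∣ x := by
    have h1 : IsCoprime ((m : ℤ) ^ 4) (q : ℤ) := (Nat.isCoprime_iff_coprime.2 hq).pow_left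
    have h2 := h1.map (Int.castRingHom R)
    simp at h2
    exact h2.dvd_of_dvd_mul_left h
  have d2 : (m : R) ^ 4 ∣ e 2 := by
    apply canc 2 h2
    obtain ⟨c, hc⟩ := p2
    push_cast
    rw [e2, hc]; exact ⟨-c, by ring⟩
  have d3 : (m : R) ^ 4 ∣ e 3 := by
    apply canc 3 h3
    obtain ⟨c, hc⟩ := p3
    push_cast
    rw [e3, hc]; exact ⟨c, by ring⟩
  have dk (k : ℕ) (hk : 4 ≤ k) : (m : R) ^ 4 ∣ e k := by
    simp only [he, MvPolynomial.esymm, map_sum, map_prod, MvPolynomial.aeval_X]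
    refine dvd_sum fun t ht => ?_
    rw [mem_powersetCard] at ht
    simp only [ha, prod_mul_distrib, prod_const, ht.2]
    exact (pow_dvd_pow _ hk).mul_right _
  rw [hprod, sum_range_succ']
  change _ ∣ ∑ k ∈ range N, e (k+1) * S ^ (N - (k+1)) + e 0 * S ^ (N - 0) - S ^ N
  rw [e0, one_mul, Nat.sub_zero, add_sub_cancel_right]
  refine dvd_sum fun k _ => Dvd.dvd.mul_right ?_ _
  match k with
  | 0 => simp [e1]
  | 1 => exact d2
  | 2 => exact d3
  | k+3 => exact dk _ (by omega)

/-- the coefficient `C(n,k)/n` -/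
def cc (n k : ℕ) : ℕ := n.choose k / n

theorem cc_mul {n k : ℕ} (hn : n.Prime) (h : k ∈ Ico 1 n) : n * cc n k = n.choose k := by
  rw [mem_Ico] at h
  exact Nat.mul_div_cancel' (hn.dvd_choose_self (by omega) h.2)

theorem cc_sq {n k : ℕ} (hn : n.Prime) (h : k ∈ Ico 1 n) (h5 : 5 ≤ n) :
    ((cc n k : ZMod n)) ^ 2 = (k : ZMod n) ^ (n - 3) := by
  have := Fact.mk hn
  have h' := mem_Ico.1 h
  have hk : (k : ZMod n) ≠ 0 := by
    rw [Ne, ZMod.natCast_eq_zero_iff]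
    exact fun hd => by have := Nat.le_of_dvd (by omega) hd; omega
  have h1 : k * cc n k = (n - 1).choose (k - 1) := by
    have := Nat.add_one_mul_choose_eq (n - 1) (k - 1)
    rw [Nat.sub_add_cancel (by omega), Nat.sub_add_cancel (by omega)] at this
    apply Nat.eq_of_mul_eq_mul_left hn.pos
    rw [this, ← cc_mul hn h]; ring
  have h2 : ∀ j < n, ((n - 1).choose j : ZMod n) = (-1) ^ j := by
    intro j
    induction j with
    | zero => simp
    | succ j ih =>
      intro hj
      have := Nat.succ_sub_one n
      have h3 : n.choose (j+1) = (n-1).choose j + (n-1).choose (j+1) := by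
        conv_lhs => rw [← Nat.sub_add_cancel hn.one_le]
        exact Nat.choose_succ_succ _ _
      have h4 : ((n.choose (j+1) : ℕ) : ZMod n) = 0 := by
        rw [ZMod.natCast_eq_zero_iff]; exact hn.dvd_choose_self (by omega) hj
      rw [h3] at h4; push_cast at h4
      rw [ih (by omega)] at h4
      rw [pow_succ]; linear_combination h4
  have h3 : ((k : ZMod n) * cc n k) ^ 2 = 1 := by
    rw [← Nat.cast_mul, h1, h2 _ (by omega), ← pow_mul, mul_comm, pow_mul]; simp
  apply mul_left_cancel₀ (pow_ne_zero 2 hk)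
  rw [← mul_pow, h3, ← pow_add, show 2 + (n - 3) = n - 1 by omega, ZMod.pow_card_sub_one_eq_one hk]

theorem sum_cc {n : ℕ} (hn : n.Prime) (h5 : 5 ≤ n) : n ∣ ∑ k ∈ Ico 1 n, cc n k ^ 2 := by
  have := Fact.mk hn
  rw [← ZMod.natCast_eq_zero_iff]
  push_cast
  rw [sum_congr rfl fun k hk => cc_sq hn hk h5]
  have := FiniteField.sum_pow_lt_card_sub_one (ZMod n) (n - 3) (by rw [ZMod.card]; omega)
  rw [← this]
  have h0 : ∑ k ∈ Ico 1 n, (k : ZMod n) ^ (n - 3) = ∑ k ∈ range n, (k : ZMod n) ^ (n - 3) := by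
    rw [range_eq_Ico, sum_eq_sum_Ico_succ_bot hn.pos]
    simp [show n - 3 ≠ 0 by omega]
  rw [h0]
  refine sum_bij' (fun k _ => (k : ZMod n)) (fun x _ => x.val) ?_ ?_ ?_ ?_ ?_
  · simp
  · intro x _; simpa using ZMod.val_lt x
  · intro k hk; simpa using ZMod.val_cast_of_lt (mem_range.1 hk)
  · simp
  · simp

section
variable {A : Type*} [CommRing A]

/-- `((w + ζ^(r+1) u)^n - w^n - u^n)/n` -/
def GG (n : ℕ) (ζ u w : A) (r : ℕ) : A :=
  ∑ k ∈ Ico 1 n, (cc n k : A) * (ζ ^ (r + 1) * u) ^ k * w ^ (n - k)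

theorem GG_spec {n : ℕ} (hn : n.Prime) (ζ u w : A) (hz : ζ ^ n = 1) (r : ℕ) :
    (w + ζ ^ (r + 1) * u) ^ n = u ^ n + w ^ n + n * GG n ζ u w r := by
  rw [add_comm w, add_pow, sum_range_succ, range_eq_Ico, sum_eq_sum_Ico_succ_bot hn.pos, GG, mul_sum]
  have : ∑ k ∈ Ico 1 n, (n : A) * ((cc n k : A) * (ζ ^ (r + 1) * u) ^ k * w ^ (n - k)) =
      ∑ k ∈ Ico (0+1) n, (ζ ^ (r + 1) * u) ^ k * w ^ (n - k) * (n.choose k : A) := by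
    refine sum_congr rfl fun k hk => ?_
    rw [← cc_mul hn hk]; push_cast; ring
  rw [this, mul_pow _ u n, ← pow_mul, mul_comm (r+1), pow_mul, hz]
  simp
  ring

theorem GG_p1 {n : ℕ} (ζ u w : A)
    (hs : ∀ m, ∑ r : Fin n, ζ ^ (((r : ℕ) + 1) * m) = if n ∣ m then (n : A) else 0) :
    ∑ r : Fin n, GG n ζ u w r = 0 := by
  simp only [GG]
  rw [sum_comm]
  refine sum_eq_zero fun k hk => ?_
  rw [mem_Ico] at hk
  have : ∀ r : Fin n, (cc n k : A) * (ζ ^ ((r : ℕ) + 1) * u) ^ k * w ^ (n - k) =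
      ζ ^ (((r : ℕ) + 1) * k) * (cc n k * u ^ k * w ^ (n-k)) := fun r => by ring
  rw [sum_congr rfl fun r _ => this r, ← sum_mul, hs, if_neg, zero_mul]
  intro hd; have := Nat.le_of_dvd (by omega) hd; omega

theorem GG_p2 {n : ℕ} (hn : n.Prime) (h5 : 5 ≤ n) (ζ u w : A)
    (hs : ∀ m, ∑ r : Fin n, ζ ^ (((r : ℕ) + 1) * m) = if n ∣ m then (n : A) else 0) :
    (n : A) ^ 2 ∣ ∑ r : Fin n, GG n ζ u w r ^ 2 := by
  simp only [GG, sq, sum_mul_sum]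
  rw [sum_comm]
  have key : ∀ k ∈ Ico 1 n, ∑ r : Fin n, ∑ l ∈ Ico 1 n,
      (cc n k : A) * (ζ ^ ((r : ℕ) + 1) * u) ^ k * w ^ (n - k) *
      ((cc n l : A) * (ζ ^ ((r : ℕ) + 1) * u) ^ l * w ^ (n - l)) =
      n * (u ^ n * w ^ n) * (cc n k : A) ^ 2 := by
    intro k hk
    rw [sum_comm]
    have hk' := mem_Ico.1 hk
    have : ∀ l ∈ Ico 1 n, ∑ r : Fin n,
      (cc n k : A) * (ζ ^ ((r : ℕ) + 1) * u) ^ k * w ^ (n - k) *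
      ((cc n l : A) * (ζ ^ ((r : ℕ) + 1) * u) ^ l * w ^ (n - l)) =
       if l = n - k then n * (u ^ n * w ^ n) * (cc n k : A) ^ 2 else 0 := by
      intro l hl
      have hl' := mem_Ico.1 hl
      have : ∀ r : Fin n, (cc n k : A) * (ζ ^ ((r : ℕ) + 1) * u) ^ k * w ^ (n - k) *
        ((cc n l : A) * (ζ ^ ((r : ℕ) + 1) * u) ^ l * w ^ (n - l)) =
        ζ ^ (((r : ℕ) + 1) * (k + l)) * (cc n k * cc n l * u ^ (k+l) * w ^ ((n-k) + (n-l))) :=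
          fun r => by ring
      rw [sum_congr rfl fun r _ => this r, ← sum_mul, hs]
      by_cases h : l = n - k
      · have e : cc n l = cc n k := by simp only [cc, h, Nat.choose_symm hk'.2.le]
        rw [if_pos h, e, show k + l = n by omega, show n - k + (n - l) = n by omega, if_pos dvd_rfl]
        ring
      · rw [if_neg h, if_neg, zero_mul]
        rintro ⟨c, hc⟩
        have : c < 2 := by by_contra hh; push Not at hh; nlinarith
        interval_cases c <;> omega
    rw [sum_congr rfl this, sum_ite_eq', if_pos]
    rw [mem_Ico]; omega
  rw [sum_congr rfl key, ← mul_sum]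
  obtain ⟨c, hc⟩ := sum_cc hn h5
  have := congrArg (Nat.cast : ℕ → A) hc
  push_cast at this
  rw [this]
  exact ⟨u ^ n * w ^ n * c, by ring⟩

theorem GG_p3 {n : ℕ} (ζ u w : A)
    (hs : ∀ m, ∑ r : Fin n, ζ ^ (((r : ℕ) + 1) * m) = if n ∣ m then (n : A) else 0) :
    (n : A) ∣ ∑ r : Fin n, GG n ζ u w r ^ 3 := by
  simp only [GG, pow_succ _ 2, sq, sum_mul_sum]
  simp only [sum_mul, mul_sum]
  rw [sum_comm]
  refine dvd_sum fun k _ => ?_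
  rw [sum_comm]
  refine dvd_sum fun l _ => ?_
  rw [sum_comm]
  refine dvd_sum fun j _ => ?_
  have : ∀ r : Fin n, (cc n k : A) * (ζ ^ ((r : ℕ) + 1) * u) ^ k * w ^ (n - k) *
        ((cc n j : A) * (ζ ^ ((r : ℕ) + 1) * u) ^ j * w ^ (n - j)) * 
        ((cc n l : A) * (ζ ^ ((r : ℕ) + 1) * u) ^ l * w ^ (n - l)) =
        ζ ^ (((r : ℕ) + 1) * (k + l + j)) * (cc n k * cc n l * cc n j * u ^ (k+l+j) * w ^ ((n-k) + (n-l) + (n-j))) :=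
          fun r => by ring
  rw [sum_congr rfl fun r _ => this r, ← sum_mul, hs]
  split_ifs <;> simp
end

theorem prod_roots {K : Type*} [CommRing K] [IsDomain K] {n : ℕ} (hn : Odd n) {ζ : K}
    (hz : IsPrimitiveRoot ζ n) (a b : K) :
    ∏ s : Fin n, (a + ζ ^ ((s : ℕ) + 1) * b) = a ^ n + b ^ n := by
  have := congrArg (Polynomial.eval a)
    (X_pow_sub_C_eq_prod hz (α := -(ζ * b)) hn.pos rfl)
  simp only [Polynomial.eval_sub, Polynomial.eval_pow, Polynomial.eval_X, Polynomial.eval_C,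
    Polynomial.eval_prod, hn.neg_pow, mul_pow, hz.pow_eq_one, one_mul, sub_neg_eq_add] at this
  rw [this, Fin.prod_univ_eq_prod_range (fun s => a + ζ ^ (s + 1) * b)]
  exact prod_congr rfl fun i _ => by ring

theorem sum_roots {K : Type*} [CommRing K] [IsDomain K] {n : ℕ} (hn : n.Prime) {ζ : K}
    (hz : IsPrimitiveRoot ζ n) (m : ℕ) :
    ∑ r : Fin n, ζ ^ (((r : ℕ) + 1) * m) = if n ∣ m then (n : K) else 0 := by
  split_ifs with h
  · obtain ⟨c, rfl⟩ := h
    have : ∀ r : Fin n, ζ ^ (((r : ℕ) + 1) * (n * c)) = 1 := fun r => by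
      rw [show ((r : ℕ) + 1) * (n * c) = n * ((r + 1) * c) by ring, pow_mul, hz.pow_eq_one, one_pow]
    simp [this]
  · have h1 : IsPrimitiveRoot (ζ ^ m) n :=
      hz.pow_of_coprime m (Nat.Coprime.symm ((Nat.Prime.coprime_iff_not_dvd hn).2 h))
    have h2 := h1.geom_sum_eq_zero hn.one_lt
    rw [Fin.sum_univ_eq_sum_range (fun r => ζ ^ ((r + 1) * m))]
    calc _ = ζ ^ m * ∑ i ∈ range n, (ζ ^ m) ^ i := by
          rw [mul_sum]; exact sum_congr rfl fun i _ => by ring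
      _ = 0 := by rw [h2, mul_zero]

/-- the standard primitive root -/
noncomputable def zet (n : ℕ) : ℂ := Complex.exp (2 * Real.pi * Complex.I / n)

theorem zet_prim {n : ℕ} (hn : n ≠ 0) : IsPrimitiveRoot (zet n) n :=
  Complex.isPrimitiveRoot_exp n hn

theorem pn_eq {n : ℕ} (hn : Odd n) (z x y : ℂ) :
    pn n z x y = ∏ r : Fin n,
      ((z ^ (n : ℂ)⁻¹ + zet n ^ ((r : ℕ) + 1) * x ^ (n : ℂ)⁻¹) ^ n + y) := by
  have h0 : n ≠ 0 := by rintro rfl; simp at hn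
  have he : ∀ r : ℕ, Complex.exp (2 * Real.pi * Complex.I * ((r : ℕ) + 1) / n) = zet n ^ (r + 1) := by
    intro r
    rw [zet, ← Complex.exp_nat_mul]
    congr 1; push_cast; ring
  simp only [pn, he]
  refine prod_congr rfl fun r _ => ?_
  rw [prod_roots hn (zet_prim h0), Complex.cpow_nat_inv_pow _ h0]

theorem pn_z0 {n : ℕ} (hn : Odd n) (x y : ℂ) : pn n 0 x y = (x + y) ^ n := by
  have h0 : n ≠ 0 := by rintro rfl; simp at hn
  rw [pn_eq hn, Complex.zero_cpow (by simpa using h0)]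
  have : ∀ r : ℕ, ((0:ℂ) + zet n ^ (r + 1) * x ^ (n : ℂ)⁻¹) ^ n = x := by
    intro r
    rw [zero_add, mul_pow, Complex.cpow_nat_inv_pow _ h0, ← pow_mul, mul_comm (r+1), pow_mul,
      (zet_prim h0).pow_eq_one, one_pow, one_mul]
  simp only [this]
  simp

theorem pn_x0 {n : ℕ} (hn : Odd n) (z y : ℂ) : pn n z 0 y = (z + y) ^ n := by
  have h0 : n ≠ 0 := by rintro rfl; simp at hn
  rw [pn_eq hn, Complex.zero_cpow (by simpa using h0)]
  simp only [mul_zero, add_zero, Complex.cpow_nat_inv_pow _ h0]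
  simp

theorem pn_y0 {n : ℕ} (hn : Odd n) (z x : ℂ) : pn n z x 0 = (z + x) ^ n := by
  have h0 : n ≠ 0 := by rintro rfl; simp at hn
  rw [pn_eq hn]
  simp only [add_zero]
  rw [prod_pow, prod_roots hn (zet_prim h0), Complex.cpow_nat_inv_pow _ h0, Complex.cpow_nat_inv_pow _ h0]

theorem X_dvd_of (D : MvPolynomial (Fin 3) ℤ) (i : Fin 3)
    (h : ∀ x : Fin 3 → ℂ, x i = 0 → MvPolynomial.eval₂ (Int.castRingHom ℂ) x D = 0) :
    MvPolynomial.X i ∣ D := by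
  classical
  set f := MvPolynomial.aeval (R := ℤ) (Function.update (MvPolynomial.X : Fin 3 → MvPolynomial (Fin 3) ℤ) i 0) with hf
  have h1 : ∀ D : MvPolynomial (Fin 3) ℤ, MvPolynomial.X i ∣ D - f D := by
    intro D
    induction D using MvPolynomial.induction_on with
    | C a => simp [hf]
    | add p q hp hq => rw [map_add, add_sub_add_comm]; exact dvd_add hp hq
    | mul_X p j hp =>
      rw [map_mul, show p * MvPolynomial.X j - f p * f (MvPolynomial.X j) =
        (p - f p) * f (MvPolynomial.X j) + p * (MvPolynomial.X j - f (MvPolynomial.X j)) by ring]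
      refine dvd_add (hp.mul_right _) (Dvd.dvd.mul_left ?_ _)
      by_cases hj : j = i
      · subst hj; simp [hf]
      · simp [hf, hj]
  have h2 : f D = 0 := by
    apply MvPolynomial.map_injective (Int.castRingHom ℂ) (RingHom.injective_int _)
    apply MvPolynomial.funext
    intro x
    rw [map_zero, map_zero, ← h (Function.update x i 0) (by simp), MvPolynomial.eval_map]
    clear h
    induction D using MvPolynomial.induction_on with
    | C a => rw [hf, MvPolynomial.aeval_C, MvPolynomial.algebraMap_eq, MvPolynomial.eval₂_C, MvPolynomial.eval₂_C]
    | add p q hp hq => simp only [map_add, MvPolynomial.eval₂_add, hp, hq]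
    | mul_X p j hp =>
      rw [map_mul, MvPolynomial.eval₂_mul, MvPolynomial.eval₂_mul, hp]
      congr 1
      by_cases hj : j = i
      · subst hj; simp [hf]
      · simp [hf, hj]
  simpa [h2] using h1 D

theorem int_dvd_of (m d : ℤ) (h : algebraMap ℤ (integralClosure ℤ ℂ) m ∣ algebraMap ℤ (integralClosure ℤ ℂ) d) :
    m ∣ d := by
  obtain ⟨c, hc⟩ := h
  by_cases hm : m = 0
  · subst hm
    rw [map_zero, zero_mul] at hc
    have := congrArg (Subtype.val) hc
    simp at this
    simp [this]
  have hc' : (d : ℂ) = m * (c : ℂ) := by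
    have := congrArg (Subtype.val) hc
    simpa using this
  have hmC : (m : ℂ) ≠ 0 := by exact_mod_cast hm
  have hq : (c : ℂ) = algebraMap ℚ ℂ ((d : ℚ) / m) := by
    simp; rw [hc']; field_simp
  have h1 : IsIntegral ℤ ((d : ℚ) / m) := by
    have h2 : IsIntegral ℤ (c : ℂ) := c.2
    rw [hq] at h2
    exact (isIntegral_algebraMap_iff (algebraMap ℚ ℂ).injective).1 h2
  obtain ⟨y, hy⟩ := IsIntegrallyClosed.isIntegral_iff.1 h1
  refine ⟨y, ?_⟩
  have hmQ : (m : ℚ) ≠ 0 := by exact_mod_cast hm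
  simp at hy
  field_simp at hy
  rw [mul_comm]
  exact_mod_cast hy.symm

theorem natCast_pow_cpow (n : ℕ) (hn : n ≠ 0) (u : ℕ) : ((u : ℂ) ^ n) ^ (n : ℂ)⁻¹ = u := by
  apply Complex.pow_cpow_nat_inv hn
  · rw [Complex.natCast_arg]; have := Real.pi_pos; have : 0 < n := by omega
    simp; positivity
  · rw [Complex.natCast_arg]; have := Real.pi_pos; positivity

open MvPolynomial in
theorem expand_eq (n : ℕ) (hn : n.Prime) (hodd : Odd n)
    (P : MvPolynomial (Fin 3) ℤ)
    (hP : ∀ x y z : ℂ, MvPolynomial.eval₂ (Int.castRingHom ℂ) ![x, y, z] P = pn n z x y)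
    (ζ : integralClosure ℤ ℂ) (hζ : (ζ : ℂ) = zet n) :
    expand n (map (algebraMap ℤ (integralClosure ℤ ℂ)) P) =
      ∏ r : Fin n, ((X 0 ^ n + X 1 ^ n + X 2 ^ n) + (n : MvPolynomial (Fin 3) (integralClosure ℤ ℂ)) *
        GG n (C ζ) (X 0) (X 2) r) := by
  have hz : ζ ^ n = 1 := by
    apply Subtype.val_injective
    push_cast
    rw [hζ, (zet_prim hn.ne_zero).pow_eq_one]
  apply funext_set (fun _ => Set.range (Nat.cast : ℕ → integralClosure ℤ ℂ))
  · intro i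
    exact Set.infinite_range_of_injective Nat.cast_injective
  intro x hx
  simp only [Set.mem_pi, Set.mem_univ, true_imp_iff, Set.mem_range] at hx
  choose v hv using hx
  obtain rfl : x = fun i => (v i : integralClosure ℤ ℂ) := by ext1 i; exact (hv i).symm
  apply Subtype.val_injective
  have hL : ((eval (fun i => (v i : integralClosure ℤ ℂ)) (expand n (map (algebraMap ℤ (integralClosure ℤ ℂ)) P)) : integralClosure ℤ ℂ) : ℂ)
      = eval₂ (Int.castRingHom ℂ) ![(v 0 : ℂ) ^ n, (v 1 : ℂ) ^ n, (v 2 : ℂ) ^ n] P := by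
    clear hP
    induction P using MvPolynomial.induction_on with
    | C a => rw [eval₂_C]; simp
    | add p q hp hq => simp only [map_add, MvPolynomial.eval₂_add, ← hp, ← hq]; push_cast; rfl
    | mul_X p j hp =>
      rw [eval₂_mul, ← hp]
      simp only [map_mul, map_X, expand_X, map_pow, eval_X, eval₂_X]
      push_cast
      congr 1
      fin_cases j <;> simp
  rw [hL, hP, pn_eq hodd, natCast_pow_cpow n hn.ne_zero, natCast_pow_cpow n hn.ne_zero]
  rw [map_prod]
  push_cast
  refine prod_congr rfl fun r _ => ?_
  have hG := GG_spec hn (C ζ) (X 0 : MvPolynomial (Fin 3) (integralClosure ℤ ℂ)) (X 2)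
    (by rw [← map_pow, hz, map_one]) r
  rw [show (X 0 ^ n + X 1 ^ n + X 2 ^ n) + (n : MvPolynomial (Fin 3) (integralClosure ℤ ℂ)) *
        GG n (C ζ) (X 0) (X 2) r = (X 2 + C ζ ^ ((r : ℕ) + 1) * X 0) ^ n + X 1 ^ n by rw [hG]; ring]
  simp [hζ]

end Aux

open MvPolynomial in
theorem statement13 (n : ℕ) (hn : n.Prime) (h5 : 5 ≤ n)
    (P : MvPolynomial (Fin 3) ℤ)
    (hP : ∀ x y z : ℂ, MvPolynomial.eval₂ (Int.castRingHom ℂ) ![x, y, z] P = pn n z x y) :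
    (∀ d : Fin 3 →₀ ℕ,
        (n : ℤ) ^ 4 ∣ MvPolynomial.coeff d (P - (X 0 + X 1 + X 2) ^ n)) ∧
      (X 0 * X 1 * X 2 : MvPolynomial (Fin 3) ℤ) ∣ (P - (X 0 + X 1 + X 2) ^ n) := by
  have hodd : Odd n := hn.odd_of_ne_two (by omega)
  have cop : ∀ q, q.Prime → q < 5 → Nat.Coprime n q := fun q hq h =>
    (Nat.coprime_primes hn hq).2 (by omega)
  constructor
  · intro d
    have hzint : IsIntegral ℤ (zet n) := (zet_prim hn.ne_zero).isIntegral hn.pos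
    let ζ : integralClosure ℤ ℂ := ⟨zet n, hzint⟩
    have hzp : IsPrimitiveRoot ζ n := by
      apply IsPrimitiveRoot.of_map_of_injective (f := (integralClosure ℤ ℂ).val) _ Subtype.val_injective
      exact zet_prim hn.ne_zero
    have hzC : IsPrimitiveRoot (C ζ : MvPolynomial (Fin 3) (integralClosure ℤ ℂ)) n :=
      hzp.map_of_injective (C_injective _ _)
    have hs := sum_roots hn hzC
    have key := newton_dvd n n (cop 2 Nat.prime_two (by omega)) (cop 3 Nat.prime_three (by omega))
      (X 0 ^ n + X 1 ^ n + X 2 ^ n) (fun r : Fin n => GG n (C ζ) (X 0 : MvPolynomial (Fin 3) (integralClosure ℤ ℂ)) (X 2) r)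
      (GG_p1 _ _ _ hs) (GG_p2 hn h5 _ _ _ hs) (GG_p3 _ _ _ hs)
    rw [← expand_eq n hn hodd P hP ζ rfl] at key
    have e : expand n (map (algebraMap ℤ (integralClosure ℤ ℂ)) (P - (X 0 + X 1 + X 2) ^ n)) =
        expand n (map (algebraMap ℤ (integralClosure ℤ ℂ)) P) - (X 0 ^ n + X 1 ^ n + X 2 ^ n) ^ n := by
      simp
    rw [← e] at key
    have e2 : (n : MvPolynomial (Fin 3) (integralClosure ℤ ℂ)) ^ 4 =
        C (algebraMap ℤ (integralClosure ℤ ℂ) ((n : ℤ) ^ 4)) := by simp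
    rw [e2, C_dvd_iff_dvd_coeff] at key
    have := key (n • d)
    rw [coeff_expand_smul n hn.ne_zero, coeff_map] at this
    exact int_dvd_of _ _ this
  · have d0 : X 0 ∣ (P - (X 0 + X 1 + X 2) ^ n) := by
      apply X_dvd_of
      intro x hx
      have := hP (x 0) (x 1) (x 2)
      rw [show ![x 0, x 1, x 2] = x by ext i; fin_cases i <;> rfl] at this
      rw [eval₂_sub, this, hx, pn_x0 hodd]
      simp [hx]; ring
    have d1 : X 1 ∣ (P - (X 0 + X 1 + X 2) ^ n) := by
      apply X_dvd_of
      intro x hx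
      have := hP (x 0) (x 1) (x 2)
      rw [show ![x 0, x 1, x 2] = x by ext i; fin_cases i <;> rfl] at this
      rw [eval₂_sub, this, hx, pn_y0 hodd]
      simp [hx]; ring
    have d2 : X 2 ∣ (P - (X 0 + X 1 + X 2) ^ n) := by
      apply X_dvd_of
      intro x hx
      have := hP (x 0) (x 1) (x 2)
      rw [show ![x 0, x 1, x 2] = x by ext i; fin_cases i <;> rfl] at this
      rw [eval₂_sub, this, hx, pn_z0 hodd]
      simp [hx]
    obtain ⟨A, hA⟩ := d0
    rw [hA] at d1 d2 ⊢
    rw [X_dvd_mul_iff] at d1 d2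
    have d1' := d1.resolve_left (by rw [X_dvd_X]; decide)
    have d2' := d2.resolve_left (by rw [X_dvd_X]; decide)
    obtain ⟨B, rfl⟩ := d1'
    rw [X_dvd_mul_iff] at d2'
    obtain ⟨E, rfl⟩ := d2'.resolve_left (by rw [X_dvd_X]; decide)
    exact ⟨E, by ring⟩
end

section
/- For every positive integers n and m, the polynomial p_n(z; x₁, …, x_m) = ∏_{s₁,…,s_m=1}^{n}(z^{1/n} + ε^{s₁}x₁^{1/n} + ⋯ + ε^{s_m}x_m^{1/n}) is irreducible as a polynomial in the variables z, x₁, …, x_m over ℂ. -/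
noncomputable def pnm (n m : ℕ) (z : ℂ) (x : Fin m → ℂ) : ℂ :=
  ∏ s : Fin m → Fin n,
    (z ^ (n : ℂ)⁻¹
      + ∑ j, Complex.exp (2 * Real.pi * Complex.I * ((s j : ℕ) + 1) / n) * (x j) ^ (n : ℂ)⁻¹)

open MvPolynomial in
/-- The linear form `X 0 + ∑ c j X (j+1)`. -/
noncomputable def linForm (m : ℕ) (c : Fin m → ℂ) : MvPolynomial (Fin (m + 1)) ℂ :=
  X 0 + ∑ j : Fin m, C (c j) * X j.succ

open MvPolynomial in
theorem linForm_irreducible (m : ℕ) (c : Fin m → ℂ) : Irreducible (linForm m c) := by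
  classical
  have h : linForm m c = sumSMulX (Finsupp.equivFunOnFinite.symm (Fin.cons 1 c)) := by
    unfold sumSMulX linForm
    rw [Finsupp.linearCombination_apply, Finsupp.sum_fintype _ _ (by simp)]
    simp [ Fin.sum_univ_succ, smul_eq_C_mul]
  rw [h]
  apply irreducible_sumSMulX
  · exact ⟨0, by simp⟩
  · intro r hr
    have := hr 0
    simp only [Finsupp.equivFunOnFinite_symm_apply_apply, Fin.cons_zero] at this
    exact isUnit_of_dvd_one this

open MvPolynomial in
theorem linForm_not_dvd (m : ℕ) (c d : Fin m → ℂ) (h : c ≠ d) :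
    ¬ linForm m c ∣ linForm m d := by
  classical
  rintro ⟨q, hq⟩
  obtain ⟨j, hj⟩ := Function.ne_iff.mp h
  have := congrArg (eval (Fin.cons (-(c j)) (Pi.single j 1) : Fin (m + 1) → ℂ)) hq
  simp [linForm, Pi.single_apply] at this
  apply hj
  linear_combination -this

open MvPolynomial in
theorem key (n m : ℕ) (hn : 0 < n) (ι : Type) [Fintype ι] [Nonempty ι]
    (c : ι → Fin m → ℂ) (hc : Function.Injective c) (hcn : ∀ s j, c s j ^ n = 1)
    (P : MvPolynomial (Fin (m + 1)) ℂ) (hP : expand n P = ∏ s, linForm m (c s)) :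
    Irreducible P := by
  classical
  have hloc := isLocalHom_expand ℂ (Fin (m+1)) hn.ne'
  have hirr := fun s => linForm_irreducible m (c s)
  have s0 : ι := Classical.arbitrary ι
  have hne : (∏ s, linForm m (c s)) ≠ 0 := Finset.prod_ne_zero_iff.mpr fun s _ => (hirr s).ne_zero
  have main : ∀ A B : MvPolynomial (Fin (m + 1)) ℂ, P = A * B →
      linForm m (c s0) ∣ expand n A → IsUnit B := by
    intro A B hAB hd
    have hall : ∀ s, linForm m (c s) ∣ expand n A := by
      intro s
      let f : Fin (m + 1) → MvPolynomial (Fin (m + 1)) ℂ :=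
        Fin.cons (X 0) (fun j => C (c s j * (c s0 j)⁻¹) * X j.succ)
      have h1 := map_dvd (aeval f : MvPolynomial (Fin (m + 1)) ℂ →ₐ[ℂ] _) hd
      have h2 : aeval f (expand n A) = expand n A := by
        rw [aeval_expand]
        have : f ^ n = fun i => X i ^ n := by
          funext i
          refine Fin.cases ?_ (fun j => ?_) i
          · simp [f]
          · simp only [f, Pi.pow_apply, Fin.cons_succ, mul_pow, ← C_pow, inv_pow, hcn]
            simp
        rw [this]
        rfl
      have h3 : aeval f (linForm m (c s0)) = linForm m (c s) := by
        unfold linForm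
        simp only [map_add, map_sum, map_mul, aeval_X, f, Fin.cons_zero, Fin.cons_succ,
          algHom_C, algebraMap_eq]
        congr 1
        refine Finset.sum_congr rfl fun j _ => ?_
        have h0 : c s0 j ≠ 0 := by
          intro h
          have := hcn s0 j
          rw [h, zero_pow hn.ne'] at this
          exact zero_ne_one this
        rw [← mul_assoc, ← C_mul, ← C_mul]
        congr 2
        field_simp
      rwa [h2, h3] at h1
    have hprod : (∏ s, linForm m (c s)) ∣ expand n A := by
      apply Finset.prod_dvd_of_isRelPrime
      · intro s _ t _ hst
        exact (hirr s).isRelPrime_iff_not_dvd.mpr (linForm_not_dvd m _ _ (hc.ne hst))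
      · intro s _
        exact hall s
    have hE : expand n A * expand n B = ∏ s, linForm m (c s) := by
      rw [← hP, hAB, map_mul]
    have hA0 : expand n A ≠ 0 := by
      intro h
      rw [h, zero_mul] at hE
      exact hne hE.symm
    rw [← hE] at hprod
    have : IsUnit (expand n B) := by
      obtain ⟨q, hq⟩ := hprod
      apply IsUnit.of_mul_eq_one q
      apply mul_left_cancel₀ hA0
      rw [← mul_assoc, ← hq, mul_one]
    exact hloc.map_nonunit B this
  have hdvd : linForm m (c s0) ∣ expand n P := by
    rw [hP]; exact Finset.dvd_prod_of_mem _ (Finset.mem_univ s0)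
  refine ⟨fun hu => ?_, fun A B hAB => ?_⟩
  · exact (hirr s0).not_isUnit (isUnit_of_dvd_unit hdvd (hu.map (expand n)))
  · rw [hAB, map_mul] at hdvd
    rcases (hirr s0).prime.dvd_or_dvd hdvd with h | h
    · exact Or.inr (main A B hAB h)
    · exact Or.inl (main B A (by rw [hAB, mul_comm]) h)

theorem statement17 (n m : ℕ) (hn : 0 < n) (hm : 0 < m)
    (P : MvPolynomial (Fin (m + 1)) ℂ)
    (hP : ∀ (z : ℂ) (x : Fin m → ℂ), MvPolynomial.eval (Fin.cons z x) P = pnm n m z x) :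
    Irreducible P := by
  classical
  have hprim := Complex.isPrimitiveRoot_exp n hn.ne'
  have hexp : ∀ k : Fin n, Complex.exp (2 * Real.pi * Complex.I * ((k : ℕ) + 1) / n)
      = Complex.exp (2 * Real.pi * Complex.I / n) ^ ((k : ℕ) + 1) := by
    intro k
    rw [← Complex.exp_nat_mul]
    congr 1
    push_cast
    ring
  have : Nonempty (Fin n) := ⟨⟨0, hn⟩⟩
  refine key n m hn (Fin m → Fin n)
    (fun s j => Complex.exp (2 * Real.pi * Complex.I * ((s j : ℕ) + 1) / n)) ?_ ?_ P ?_
  · intro s t hst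
    funext j
    have h := congrFun hst j
    simp only [hexp, pow_succ] at h
    have h' := mul_right_cancel₀ (Complex.exp_ne_zero _) h
    exact Fin.ext (hprim.pow_inj (s j).2 (t j).2 h')
  · intro s j
    simp only [hexp]
    rw [pow_right_comm, hprim.pow_eq_one, one_pow]
  · refine MvPolynomial.funext_set (fun _ => (fun r : ℝ => (r : ℂ)) '' Set.Ioi 0)
      (fun _ => (Set.Ioi_infinite 0).image Complex.ofReal_injective.injOn) fun x hx => ?_
    have hroot : ∀ i, (x i ^ n) ^ (n : ℂ)⁻¹ = x i := by
      intro i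
      obtain ⟨r, hr, hrx⟩ := hx i (Set.mem_univ i)
      have hr0 : (0 : ℝ) < r := hr
      have hpn : 0 < Real.pi / n := div_pos Real.pi_pos (Nat.cast_pos.mpr hn)
      have ha : (x i).arg = 0 := by
        rw [← hrx]; exact Complex.arg_ofReal_of_nonneg hr0.le
      apply Complex.pow_cpow_nat_inv hn.ne' <;> rw [ha] <;> linarith
    have hcons : x ^ n = Fin.cons (x 0 ^ n) (fun j : Fin m => x j.succ ^ n) := by
      funext i
      refine Fin.cases ?_ (fun j => ?_) i <;> simp
    rw [MvPolynomial.eval_expand, hcons, hP, pnm, map_prod]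
    refine Finset.prod_congr rfl fun s _ => ?_
    simp [linForm, hroot]
end

section
/- Let x₁, …, x_m be pairwise coprime positive integers and n ≥ 2 an integer such that for each j and each positive integer k < n, the real number (x_j^{1/n})^k is irrational. Then the minimal polynomial over ℚ of θ = x₁^{1/n} + ⋯ + x_m^{1/n} has degree n^m; equivalently, the characteristic polynomial in z of the Kronecker sum of the companion matrices of tⁿ − x_j (j = 1,…,m) is irreducible over ℚ. -/
open Polynomial

/-- A positive irrational real with a rational power has minimal polynomial `X ^ r - c`. -/
lemma aux_minpoly (α : ℝ) (hα : 0 < α) (n : ℕ) (hn : 0 < n) (q : ℚ) (h : α ^ n = q)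
    (hirr : Irrational α) : (minpoly ℚ α).nextCoeff = 0 := by
  have hroot : aeval α ((X : ℚ[X]) ^ n - C q) = 0 := by simp [h]
  have hint : IsIntegral ℚ α := ⟨X ^ n - C q, monic_X_pow_sub_C q hn.ne', by
    simpa [aeval_def] using hroot⟩
  have hdvd := minpoly.dvd ℚ α hroot
  set p := minpoly ℚ α with hp
  have hmonic : p.Monic := minpoly.monic hint
  have hnorm : ∀ z ∈ (p.map (algebraMap ℚ ℂ)).roots, ‖z‖ = α := by
    intro z hz
    have hz' : aeval z p = 0 := by
      have := (mem_roots'.1 hz).2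
      rwa [IsRoot, eval_map_algebraMap] at this
    have h2 : aeval z ((X : ℚ[X]) ^ n - C q) = 0 := by
      obtain ⟨s, hs⟩ := hdvd
      rw [hs, map_mul, hz', zero_mul]
    have h3 : z ^ n = (q : ℂ) := by simpa [sub_eq_zero] using h2
    have h4 : (q : ℂ) = ((α : ℝ) : ℂ) ^ n := by
      rw [← Complex.ofReal_pow, h]; simp
    have h5 : ‖z‖ ^ n = α ^ n := by
      rw [← norm_pow, h3, h4, norm_pow, Complex.norm_real, Real.norm_of_nonneg hα.le]
    exact (pow_left_inj₀ (norm_nonneg _) hα.le hn.ne').1 h5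
  have hsplit : (p.map (algebraMap ℚ ℂ)).Splits := IsAlgClosed.splits _
  have hcard : (p.map (algebraMap ℚ ℂ)).roots.card = p.natDegree := by
    rw [← hsplit.natDegree_eq_card_roots, natDegree_map]
  have hc := hsplit.coeff_zero_eq_prod_roots_of_monic (hmonic.map _)
  have hprod : ‖(p.map (algebraMap ℚ ℂ)).roots.prod‖ = α ^ p.natDegree := by
    rw [← hcard]
    have : ∀ s : Multiset ℂ, (∀ z ∈ s, ‖z‖ = α) → ‖s.prod‖ = α ^ s.card := by
      intro s
      induction s using Multiset.induction_on with
      | empty => simp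
      | cons a s ih =>
        intro hs
        rw [Multiset.prod_cons, norm_mul, Multiset.card_cons, pow_succ,
          ih (fun z hz => hs z (Multiset.mem_cons_of_mem hz)),
          hs a (Multiset.mem_cons_self a s), mul_comm]
    exact this _ hnorm
  have hαr : α ^ p.natDegree = ((|p.coeff 0| : ℚ) : ℝ) := by
    rw [← hprod]
    have := congrArg norm hc
    rw [norm_mul, norm_pow, norm_neg, norm_one, one_pow, one_mul] at this
    rw [← this, coeff_map]
    simp
  have hdeg : 2 ≤ p.natDegree := by
    have h0 : 0 < p.natDegree := minpoly.natDegree_pos hint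
    by_contra hlt
    have h1 : p.natDegree = 1 := by omega
    rw [h1, pow_one] at hαr
    exact hirr ⟨_, hαr.symm⟩
  have hpe : p = X ^ p.natDegree - C |p.coeff 0| := by
    have hm : (X ^ p.natDegree - C |p.coeff 0| : ℚ[X]).Monic := monic_X_pow_sub_C _ (by omega)
    have hd : p ∣ X ^ p.natDegree - C |p.coeff 0| := minpoly.dvd ℚ α (by simp [hαr])
    exact (eq_of_monic_of_dvd_of_natDegree_le hmonic hm hd
      (by rw [natDegree_X_pow_sub_C])).symm
  rw [hpe, nextCoeff_of_natDegree_pos (by rw [natDegree_X_pow_sub_C]; omega),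
    natDegree_X_pow_sub_C, coeff_sub, coeff_X_pow, coeff_C]
  rw [if_neg (by omega), if_neg (by omega), sub_zero]

lemma aux_coprime (m n : ℕ) (hn : 2 ≤ n) (x : Fin m → ℕ)
    (hcop : ∀ i j, i ≠ j → Nat.Coprime (x i) (x j)) (a : Fin m → ℝ) (ha : ∀ j, 0 < a j)
    (hax : ∀ j, a j ^ n = x j)
    (hirr : ∀ j, ∀ k : ℕ, 0 < k → k < n → Irrational (a j ^ k))
    (g : Fin m → ℕ) (q : ℚ) (hq : ∏ j, a j ^ g j = q) (j : Fin m) : ∃ d : ℕ, a j ^ g j = d := by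
  have h1 : ((∏ j, x j ^ g j : ℕ) : ℝ) = ((q ^ n : ℚ) : ℝ) := by
    push_cast
    rw [← hq, ← Finset.prod_pow]
    refine Finset.prod_congr rfl fun j _ => ?_
    rw [← hax, ← pow_mul, ← pow_mul, mul_comm]
  have h2 : ((∏ j, x j ^ g j : ℕ) : ℚ) = q ^ n := by exact_mod_cast h1
  have hqpos : 0 ≤ q := by
    have : (0 : ℝ) ≤ q := by
      rw [← hq]; exact Finset.prod_nonneg fun j _ => (pow_pos (ha j) _).le
    exact_mod_cast this
  have hden : q.den = 1 := by
    have := congrArg Rat.den h2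
    rw [Rat.den_pow, Rat.den_natCast] at this
    exact (Nat.pow_eq_one.1 this.symm).resolve_right (by omega)
  have hqn : q = (q.num.toNat : ℕ) := by
    have h3 : (q.num.toNat : ℤ) = q.num := Int.toNat_of_nonneg (Rat.num_nonneg.2 hqpos)
    have h4 : (q.num : ℚ) = q := (Rat.den_eq_one_iff q).1 hden
    rw [← Int.cast_natCast, h3, h4]
  have h5 : ∏ j, x j ^ g j = q.num.toNat ^ n := by
    rw [hqn] at h2
    exact_mod_cast h2
  classical
  rw [← Finset.mul_prod_erase _ _ (Finset.mem_univ j)] at h5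
  have hc : Nat.Coprime (x j ^ g j) (∏ i ∈ Finset.univ.erase j, x i ^ g i) :=
    Nat.Coprime.prod_right fun i hi =>
      Nat.Coprime.pow _ _ (hcop j i (Finset.ne_of_mem_erase hi).symm)
  obtain ⟨d, hd⟩ := exists_eq_pow_of_mul_eq_pow (a := x j ^ g j) (by
    rw [Nat.isUnit_iff]; exact hc) h5
  refine ⟨d, ?_⟩
  refine (pow_left_inj₀ (pow_pos (ha j) _).le d.cast_nonneg (by omega : n ≠ 0)).1 ?_
  rw [← pow_mul, mul_comm, pow_mul, hax]
  exact_mod_cast hd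

lemma aux_ratio (m n : ℕ) (hn : 2 ≤ n) (x : Fin m → ℕ)
    (hcop : ∀ i j, i ≠ j → Nat.Coprime (x i) (x j)) (a : Fin m → ℝ) (ha : ∀ j, 0 < a j)
    (hax : ∀ j, a j ^ n = x j)
    (hirr : ∀ j, ∀ k : ℕ, 0 < k → k < n → Irrational (a j ^ k))
    (e f : Fin m → Fin n) (hef : e ≠ f) :
    Irrational ((∏ j, a j ^ (e j : ℕ)) / ∏ j, a j ^ (f j : ℕ)) := by
  rintro ⟨q, hq⟩
  apply hef
  have hpos : 0 < ∏ j, a j ^ (f j : ℕ) := Finset.prod_pos fun j _ => pow_pos (ha j) _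
  have hkey : ∏ j, a j ^ ((e j : ℕ) + (n - f j)) = ((q * ∏ j, (x j : ℚ) : ℚ) : ℝ) := by
    push_cast
    rw [hq, div_mul_eq_mul_div, eq_div_iff hpos.ne', ← Finset.prod_mul_distrib,
      ← Finset.prod_mul_distrib]
    refine Finset.prod_congr rfl fun j _ => ?_
    rw [← hax, ← pow_add, ← pow_add]
    congr 1
    have := (f j).2
    omega
  ext j
  obtain ⟨d, hd⟩ := aux_coprime m n hn x hcop a ha hax hirr _ _ hkey j
  have h1 := (e j).2
  have h2 := (f j).2
  rcases lt_trichotomy (e j : ℕ) (f j : ℕ) with h | h | h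
  · exact absurd ⟨(d : ℚ), by rw [hd]; simp⟩ (hirr j (e j + (n - f j)) (by omega) (by omega))
  · exact h
  · have h3 : (e j : ℕ) + (n - f j) = n + (e j - f j) := by omega
    rw [h3, pow_add] at hd
    refine absurd ⟨(d / x j : ℚ), ?_⟩ (hirr j (e j - f j) (by omega) (by omega))
    push_cast
    rw [← hax, ← hd, mul_div_cancel_left₀ _ (pow_pos (ha j) n).ne']

theorem aux_main (m n : ℕ) (hn : 2 ≤ n) (x : Fin m → ℕ)
    (hcop : ∀ i j, i ≠ j → Nat.Coprime (x i) (x j)) (a : Fin m → ℝ) (ha : ∀ j, 0 < a j)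
    (hax : ∀ j, a j ^ n = x j)
    (hirr : ∀ j, ∀ k : ℕ, 0 < k → k < n → Irrational (a j ^ k)) :
    (minpoly ℚ (∑ j, a j)).natDegree = n ^ m := by
  have hint : ∀ j, IsIntegral ℚ (a j) := fun j =>
    ⟨X ^ n - C (x j : ℚ), monic_X_pow_sub_C _ (by omega), by simp [hax]⟩
  let K := IntermediateField.adjoin ℚ (Set.range a)
  haveI : FiniteDimensional ℚ K :=
    IntermediateField.finiteDimensional_adjoin (by rintro _ ⟨j, rfl⟩; exact hint j)
  let b : Fin m → K := fun j => ⟨a j, IntermediateField.subset_adjoin _ _ ⟨j, rfl⟩⟩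
  have hb : ∀ j, ((b j : K) : ℝ) = a j := fun j => rfl
  have hbx : ∀ j, b j ^ n = (x j : K) := fun j => Subtype.ext (by
    simpa [hb] using hax j)
  have hext : ∀ φ ψ : K →ₐ[ℚ] ℂ, (∀ j, φ (b j) = ψ (b j)) → φ = ψ := by
    intro φ ψ h
    apply IntermediateField.adjoin_algHom_ext
    rintro _ ⟨j, rfl⟩
    exact h j
  have hφx : ∀ (φ : K →ₐ[ℚ] ℂ) j, φ (b j) ^ n = (x j : ℂ) := by
    intro φ j
    rw [← map_pow, hbx, map_natCast]
  -- upper bound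
  have hle : Module.finrank ℚ K ≤ n ^ m := by
    classical
    rw [← AlgHom.card ℚ K ℂ]
    let F : (K →ₐ[ℚ] ℂ) → (∀ j : Fin m, (nthRoots n (x j : ℂ)).toFinset) := fun φ j =>
      ⟨φ (b j), by rw [Multiset.mem_toFinset, mem_nthRoots (by omega)]; exact hφx φ j⟩
    have hF : Function.Injective F := fun φ ψ h => hext φ ψ fun j =>
      congrArg Subtype.val (congrFun h j)
    refine (Fintype.card_le_of_injective F hF).trans ?_
    rw [Fintype.card_pi]
    calc _ ≤ ∏ _j : Fin m, n := Finset.prod_le_prod' fun j _ => by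
            rw [Fintype.card_coe]
            exact (Multiset.toFinset_card_le _).trans (card_nthRoots _ _)
      _ = n ^ m := by simp
  -- lower bound
  have hli : LinearIndependent ℚ (fun e : Fin m → Fin n => ∏ j, b j ^ (e j : ℕ)) := by
    rw [Fintype.linearIndependent_iff]
    intro c hc f
    have hbne : ∀ j, b j ≠ 0 := fun j h => (ha j).ne' (by rw [← hb, h]; rfl)
    have hfne : ∏ j, b j ^ (f j : ℕ) ≠ 0 := Finset.prod_ne_zero_iff.2 fun j _ =>
      pow_ne_zero _ (hbne j)
    have h1 : ∑ e, c e • ((∏ j, b j ^ (e j : ℕ)) / ∏ j, b j ^ (f j : ℕ)) = 0 := by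
      have := congrArg (· / ∏ j, b j ^ (f j : ℕ)) hc
      simpa only [Finset.sum_div, zero_div, smul_div_assoc] using this
    have h2 := congrArg (Algebra.trace ℚ K) h1
    rw [map_sum, map_zero, Finset.sum_eq_single f] at h2
    · rw [map_smul, div_self hfne, ← map_one (algebraMap ℚ K), Algebra.trace_algebraMap] at h2
      have h3 : Module.finrank ℚ K ≠ 0 := Module.finrank_pos.ne'
      simpa [h3] using h2
    · intro e _ hef
      rw [map_smul, trace_eq_finrank_mul_minpoly_nextCoeff]
      have h4 := aux_ratio m n hn x hcop a ha hax hirr e f hef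
      have h5 := aux_minpoly ((∏ j, a j ^ (e j : ℕ)) / ∏ j, a j ^ (f j : ℕ))
        (div_pos (Finset.prod_pos fun j _ => pow_pos (ha j) _)
          (Finset.prod_pos fun j _ => pow_pos (ha j) _)) n (by omega)
        ((∏ j, (x j : ℚ) ^ (e j : ℕ)) / ∏ j, (x j : ℚ) ^ (f j : ℕ)) (by
          push_cast
          rw [div_pow, ← Finset.prod_pow, ← Finset.prod_pow]
          simp only [← hax, ← pow_mul, mul_comm]) h4
      have h6 : (((∏ j, b j ^ (e j : ℕ)) / ∏ j, b j ^ (f j : ℕ) : K) : ℝ) =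
          (∏ j, a j ^ (e j : ℕ)) / ∏ j, a j ^ (f j : ℕ) := by
        have := map_div₀ (algebraMap K ℝ) (∏ j, b j ^ (e j : ℕ)) (∏ j, b j ^ (f j : ℕ))
        rw [map_prod, map_prod] at this
        simp only [map_pow] at this
        exact this
      have h7 := minpoly.algebraMap_eq (A := ℚ) (B := K) (B' := ℝ) (algebraMap K ℝ).injective
        ((∏ j, b j ^ (e j : ℕ)) / ∏ j, b j ^ (f j : ℕ))
      rw [← h7]
      have h8 : algebraMap K ℝ ((∏ j, b j ^ (e j : ℕ)) / ∏ j, b j ^ (f j : ℕ)) =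
          (∏ j, a j ^ (e j : ℕ)) / ∏ j, a j ^ (f j : ℕ) := h6
      rw [h8, h5]
      simp
    · simp
  have hge : n ^ m ≤ Module.finrank ℚ K := by
    have := hli.fintype_card_le_finrank
    simpa using this
  -- primitive element
  have hprim : IntermediateField.adjoin ℚ {∑ j, b j} = (⊤ : IntermediateField ℚ K) := by
    let φ : K →ₐ[ℚ] ℂ := (IsScalarTower.toAlgHom ℚ ℝ ℂ).comp K.val
    have hφ : ∀ j, φ (b j) = (a j : ℂ) := fun j => rfl
    rw [Field.primitive_element_iff_algHom_eq_of_eval ℚ ℂ (fun _ => IsAlgClosed.splits _) _ φ]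
    intro ψ h
    apply hext
    have hnorm : ∀ j, ‖ψ (b j)‖ = a j := by
      intro j
      refine (pow_left_inj₀ (norm_nonneg _) (ha j).le (by omega : n ≠ 0)).1 ?_
      rw [← norm_pow, hφx, hax]; simp
    have hre : ∀ j, (ψ (b j)).re ≤ a j := fun j => (Complex.re_le_norm _).trans_eq (hnorm j)
    have hsum : ∑ j, (ψ (b j)).re = ∑ j, a j := by
      rw [map_sum, map_sum] at h
      have := congrArg Complex.re h
      simp only [hφ, Complex.re_sum, Complex.ofReal_re] at this
      exact this.symm
    have heq := (Finset.sum_eq_sum_iff_of_le (fun j _ => hre j)).1 hsum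
    intro j
    rw [hφ]
    have h1 : (ψ (b j)).re = a j := heq j (Finset.mem_univ j)
    have h2 := Complex.sq_norm (ψ (b j))
    rw [hnorm, Complex.normSq_apply, h1] at h2
    have h4 : (ψ (b j)).im = 0 := by nlinarith
    exact Complex.ext (by simp [h1]) (by simp [h4])
  rw [Field.primitive_element_iff_minpoly_natDegree_eq] at hprim
  have h7 := minpoly.algebraMap_eq (A := ℚ) (B := K) (B' := ℝ) (algebraMap K ℝ).injective
    (∑ j, b j)
  have h8 : algebraMap K ℝ (∑ j, b j) = ∑ j, a j := by rw [map_sum]; rfl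
  rw [← h8, h7, hprim]
  exact le_antisymm hle hge

theorem statement18 (m n : ℕ) (hn : 2 ≤ n) (x : Fin m → ℕ) (hx : ∀ j, 0 < x j)
    (hcop : ∀ i j, i ≠ j → Nat.Coprime (x i) (x j))
    (hirr : ∀ j, ∀ k : ℕ, 0 < k → k < n → Irrational (((x j : ℝ) ^ ((n : ℝ)⁻¹)) ^ k)) :
    (minpoly ℚ (∑ j, (x j : ℝ) ^ ((n : ℝ)⁻¹))).natDegree = n ^ m :=
  aux_main m n hn x hcop (fun j => (x j : ℝ) ^ ((n : ℝ)⁻¹))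
    (fun j => Real.rpow_pos_of_pos (by exact_mod_cast hx j) _)
    (fun j => Real.rpow_inv_natCast_pow (Nat.cast_nonneg _) (by omega)) hirr
end
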